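/- Let u : ℝ² × ℝ → ℝ and q₁, q₂ : ℝ² × ℝ → ℝ be smooth functions, 2π-periodic in each of the two spatial variables, satisfying ∂ₜu = Δu + ∂₁(u·q₁) + ∂₂(u·q₂) and ∂ₜqᵢ = u·∂ᵢu for i = 1, 2. Then for every t ∈ ℝ the function t ↦ (1/2)∫_{[0,2π]²} (u² + q₁² + q₂²) dx has derivative at t equal to −∫_{[0,2π]²} ((∂₁u)² + (∂₂u)²) dx. -/

import Mathlib

open Real

/-- Partial derivative in the first spatial variable of a function on ℝ² × ℝ. -/
noncomputable def pd1 (f : (ℝ × ℝ) × ℝ → ℝ) (p : (ℝ × ℝ) × ℝ) : ℝ :=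
  deriv (fun z => f ((z, p.1.2), p.2)) p.1.1

/-- Partial derivative in the second spatial variable of a function on ℝ² × ℝ. -/
noncomputable def pd2 (f : (ℝ × ℝ) × ℝ → ℝ) (p : (ℝ × ℝ) × ℝ) : ℝ :=
  deriv (fun z => f ((p.1.1, z), p.2)) p.1.2

/-- Partial derivative in the time variable of a function on ℝ² × ℝ. -/
noncomputable def pdt (f : (ℝ × ℝ) × ℝ → ℝ) (p : (ℝ × ℝ) × ℝ) : ℝ :=
  deriv (fun s => f (p.1, s)) p.2

/-- Spatial Laplacian Δ = ∂₁₁ + ∂₂₂ of a function on ℝ² × ℝ. -/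
noncomputable def lap (f : (ℝ × ℝ) × ℝ → ℝ) (p : (ℝ × ℝ) × ℝ) : ℝ :=
  pd1 (pd1 f) p + pd2 (pd2 f) p

lemma aux_param (a b : ℝ) (F F' : ℝ → ℝ → ℝ) (hF : Continuous (Function.uncurry F))
    (hF' : Continuous (Function.uncurry F'))
    (h : ∀ s x, HasDerivAt (fun s => F s x) (F' s x) s) (t : ℝ) :
    HasDerivAt (fun s => ∫ x in a..b, F s x) (∫ x in a..b, F' t x) t := by
  obtain ⟨C, hC⟩ := ((isCompact_closedBall t 1).prod (isCompact_uIcc (a := a) (b := b))).exists_bound_of_continuousOn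
    hF'.continuousOn
  have c1 : ∀ s, Continuous (F s) := fun s => hF.comp (by fun_prop : Continuous fun x : ℝ => (s, x))
  have c2 : ∀ s, Continuous (F' s) := fun s => hF'.comp (by fun_prop : Continuous fun x : ℝ => (s, x))
  refine (intervalIntegral.hasDerivAt_integral_of_dominated_loc_of_deriv_le (bound := fun _ => C)
    (Metric.ball_mem_nhds t one_pos) ?_ ((c1 t).intervalIntegrable _ _) (c2 t).aestronglyMeasurable
    ?_ (by simp) ?_).2
  · exact Filter.Eventually.of_forall fun s => (c1 s).aestronglyMeasurable
  · refine Filter.Eventually.of_forall fun x hx s hs => ?_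
    exact hC (s, x) ⟨Metric.ball_subset_closedBall hs, Set.uIoc_subset_uIcc hx⟩
  · exact Filter.Eventually.of_forall fun x _ s _ => h s x

lemma aux_pd1 {f : (ℝ × ℝ) × ℝ → ℝ} (hf : ContDiff ℝ (⊤ : ℕ∞) f) (x y t : ℝ) :
    HasDerivAt (fun z => f ((z, y), t)) (fderiv ℝ f ((x, y), t) ((1, 0), 0)) x := by
  have h1 : HasDerivAt (fun z : ℝ => ((z, y), t)) ((1, 0), 0) x :=
    ((hasDerivAt_id x).prodMk (hasDerivAt_const x y)).prodMk (hasDerivAt_const x t)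
  exact ((hf.differentiable (by simp)) ((x, y), t)).hasFDerivAt.comp_hasDerivAt x h1

lemma aux_pd2 {f : (ℝ × ℝ) × ℝ → ℝ} (hf : ContDiff ℝ (⊤ : ℕ∞) f) (x y t : ℝ) :
    HasDerivAt (fun z => f ((x, z), t)) (fderiv ℝ f ((x, y), t) ((0, 1), 0)) y := by
  have h1 : HasDerivAt (fun z : ℝ => ((x, z), t)) ((0, 1), 0) y :=
    ((hasDerivAt_const y x).prodMk (hasDerivAt_id y)).prodMk (hasDerivAt_const y t)
  exact ((hf.differentiable (by simp)) ((x, y), t)).hasFDerivAt.comp_hasDerivAt y h1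

lemma aux_pdt {f : (ℝ × ℝ) × ℝ → ℝ} (hf : ContDiff ℝ (⊤ : ℕ∞) f) (x y t : ℝ) :
    HasDerivAt (fun z => f ((x, y), z)) (fderiv ℝ f ((x, y), t) ((0, 0), 1)) t := by
  have h1 : HasDerivAt (fun z : ℝ => ((x, y), z)) ((0, 0), 1) t :=
    (hasDerivAt_const t (x, y)).prodMk (hasDerivAt_id t)
  exact ((hf.differentiable (by simp)) ((x, y), t)).hasFDerivAt.comp_hasDerivAt t h1

lemma aux_smooth {f : (ℝ × ℝ) × ℝ → ℝ} (hf : ContDiff ℝ (⊤ : ℕ∞) f) (v : (ℝ × ℝ) × ℝ) :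
    ContDiff ℝ (⊤ : ℕ∞) (fun p => fderiv ℝ f p v) :=
  (hf.fderiv_right (by simp)).clm_apply contDiff_const

lemma pd1_eq {f : (ℝ × ℝ) × ℝ → ℝ} (hf : ContDiff ℝ (⊤ : ℕ∞) f) :
    pd1 f = fun p => fderiv ℝ f p ((1, 0), 0) := by
  funext p
  exact (aux_pd1 hf p.1.1 p.1.2 p.2).deriv

lemma pd2_eq {f : (ℝ × ℝ) × ℝ → ℝ} (hf : ContDiff ℝ (⊤ : ℕ∞) f) :
    pd2 f = fun p => fderiv ℝ f p ((0, 1), 0) := by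
  funext p
  exact (aux_pd2 hf p.1.1 p.1.2 p.2).deriv

lemma pdt_eq {f : (ℝ × ℝ) × ℝ → ℝ} (hf : ContDiff ℝ (⊤ : ℕ∞) f) :
    pdt f = fun p => fderiv ℝ f p ((0, 0), 1) := by
  funext p
  exact (aux_pdt hf p.1.1 p.1.2 p.2).deriv

lemma sm1 {f : (ℝ × ℝ) × ℝ → ℝ} (hf : ContDiff ℝ (⊤ : ℕ∞) f) : ContDiff ℝ (⊤ : ℕ∞) (pd1 f) := by
  rw [pd1_eq hf]; exact aux_smooth hf _

lemma sm2 {f : (ℝ × ℝ) × ℝ → ℝ} (hf : ContDiff ℝ (⊤ : ℕ∞) f) : ContDiff ℝ (⊤ : ℕ∞) (pd2 f) := by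
  rw [pd2_eq hf]; exact aux_smooth hf _

lemma smt {f : (ℝ × ℝ) × ℝ → ℝ} (hf : ContDiff ℝ (⊤ : ℕ∞) f) : ContDiff ℝ (⊤ : ℕ∞) (pdt f) := by
  rw [pdt_eq hf]; exact aux_smooth hf _

lemma hd1 {f : (ℝ × ℝ) × ℝ → ℝ} (hf : ContDiff ℝ (⊤ : ℕ∞) f) (x y t : ℝ) :
    HasDerivAt (fun z => f ((z, y), t)) (pd1 f ((x, y), t)) x := by
  rw [pd1_eq hf]; exact aux_pd1 hf x y t

lemma hd2 {f : (ℝ × ℝ) × ℝ → ℝ} (hf : ContDiff ℝ (⊤ : ℕ∞) f) (x y t : ℝ) :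
    HasDerivAt (fun z => f ((x, z), t)) (pd2 f ((x, y), t)) y := by
  rw [pd2_eq hf]; exact aux_pd2 hf x y t

lemma hdt {f : (ℝ × ℝ) × ℝ → ℝ} (hf : ContDiff ℝ (⊤ : ℕ∞) f) (x y t : ℝ) :
    HasDerivAt (fun z => f ((x, y), z)) (pdt f ((x, y), t)) t := by
  rw [pdt_eq hf]; exact aux_pdt hf x y t

lemma pd1_mul {f g : (ℝ × ℝ) × ℝ → ℝ} (hf : ContDiff ℝ (⊤ : ℕ∞) f) (hg : ContDiff ℝ (⊤ : ℕ∞) g)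
    (p : (ℝ × ℝ) × ℝ) : pd1 (fun r => f r * g r) p = pd1 f p * g p + f p * pd1 g p :=
  ((hd1 hf p.1.1 p.1.2 p.2).mul (hd1 hg p.1.1 p.1.2 p.2)).deriv

lemma pd2_mul {f g : (ℝ × ℝ) × ℝ → ℝ} (hf : ContDiff ℝ (⊤ : ℕ∞) f) (hg : ContDiff ℝ (⊤ : ℕ∞) g)
    (p : (ℝ × ℝ) × ℝ) : pd2 (fun r => f r * g r) p = pd2 f p * g p + f p * pd2 g p :=
  ((hd2 hf p.1.1 p.1.2 p.2).mul (hd2 hg p.1.1 p.1.2 p.2)).deriv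

lemma pd1_per {f : (ℝ × ℝ) × ℝ → ℝ} 
    (h : ∀ x y t : ℝ, f ((x + 2 * π, y), t) = f ((x, y), t)) (x y t : ℝ) :
    pd1 f ((x + 2 * π, y), t) = pd1 f ((x, y), t) := by
  have := deriv_comp_add_const (fun z => f ((z, y), t)) (2 * π) x
  simp only [h] at this
  exact this.symm

lemma pd2_per {f : (ℝ × ℝ) × ℝ → ℝ} 
    (h : ∀ x y t : ℝ, f ((x, y + 2 * π), t) = f ((x, y), t)) (x y t : ℝ) :
    pd2 f ((x, y + 2 * π), t) = pd2 f ((x, y), t) := by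
  have := deriv_comp_add_const (fun z => f ((x, z), t)) (2 * π) y
  simp only [h] at this
  exact this.symm

lemma int_pd2 {f : (ℝ × ℝ) × ℝ → ℝ} (hf : ContDiff ℝ (⊤ : ℕ∞) f)
    (h : ∀ x y t : ℝ, f ((x, y + 2 * π), t) = f ((x, y), t)) (x t : ℝ) :
    ∫ y in (0:ℝ)..(2 * π), pd2 f ((x, y), t) = 0 := by
  have hc := (sm2 hf).continuous
  rw [intervalIntegral.integral_eq_sub_of_hasDerivAt (fun y _ => hd2 hf x y t)
    ((hc.comp (by fun_prop : Continuous fun y : ℝ => ((x, y), t))).intervalIntegrable _ _)]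
  have := h x 0 t
  rw [zero_add] at this
  rw [this, sub_self]

lemma int_pd1 {f : (ℝ × ℝ) × ℝ → ℝ} (hf : ContDiff ℝ (⊤ : ℕ∞) f)
    (h : ∀ x y t : ℝ, f ((x + 2 * π, y), t) = f ((x, y), t)) (t : ℝ) :
    ∫ x in (0:ℝ)..(2 * π), ∫ y in (0:ℝ)..(2 * π), pd1 f ((x, y), t) = 0 := by
  have hc := (sm1 hf).continuous
  have hc0 := hf.continuous
  have hd : ∀ x, HasDerivAt (fun x => ∫ y in (0:ℝ)..(2 * π), f ((x, y), t))
      (∫ y in (0:ℝ)..(2 * π), pd1 f ((x, y), t)) x := fun x =>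
    aux_param 0 (2 * π) (fun x y => f ((x, y), t)) (fun x y => pd1 f ((x, y), t))
      (hc0.comp (by fun_prop : Continuous fun p : ℝ × ℝ => ((p.1, p.2), t)))
      (hc.comp (by fun_prop : Continuous fun p : ℝ × ℝ => ((p.1, p.2), t)))
      (fun x y => hd1 hf x y t) x
  rw [intervalIntegral.integral_eq_sub_of_hasDerivAt (fun x _ => hd x)]
  · have := fun y => h 0 y t
    simp only [zero_add] at this
    simp only [this, sub_self]
  · apply Continuous.intervalIntegrable
    exact intervalIntegral.continuous_parametric_intervalIntegral_of_continuous' (f := fun x y => pd1 f ((x, y), t))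
      (hc.comp (by fun_prop : Continuous fun p : ℝ × ℝ => ((p.1, p.2), t))) _ _

lemma int_pdt {f : (ℝ × ℝ) × ℝ → ℝ} (hf : ContDiff ℝ (⊤ : ℕ∞) f) (t : ℝ) :
    HasDerivAt (fun s => ∫ x in (0:ℝ)..(2 * π), ∫ y in (0:ℝ)..(2 * π), f ((x, y), s))
      (∫ x in (0:ℝ)..(2 * π), ∫ y in (0:ℝ)..(2 * π), pdt f ((x, y), t)) t := by
  have hc := (smt hf).continuous
  have hc0 := hf.continuous
  refine aux_param 0 (2 * π) (fun s x => ∫ y in (0:ℝ)..(2 * π), f ((x, y), s))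
    (fun s x => ∫ y in (0:ℝ)..(2 * π), pdt f ((x, y), s)) ?_ ?_ ?_ t
  · exact intervalIntegral.continuous_parametric_intervalIntegral_of_continuous'
      (f := fun (p : ℝ × ℝ) y => f ((p.2, y), p.1))
      (hc0.comp (by fun_prop : Continuous fun p : (ℝ × ℝ) × ℝ => ((p.1.2, p.2), p.1.1))) _ _
  · exact intervalIntegral.continuous_parametric_intervalIntegral_of_continuous'
      (f := fun (p : ℝ × ℝ) y => pdt f ((p.2, y), p.1))
      (hc.comp (by fun_prop : Continuous fun p : (ℝ × ℝ) × ℝ => ((p.1.2, p.2), p.1.1))) _ _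
  · intro s x
    exact aux_param 0 (2 * π) (fun s y => f ((x, y), s)) (fun s y => pdt f ((x, y), s))
      (hc0.comp (by fun_prop : Continuous fun p : ℝ × ℝ => ((x, p.2), p.1)))
      (hc.comp (by fun_prop : Continuous fun p : ℝ × ℝ => ((x, p.2), p.1)))
      (fun s y => hdt hf x y s) s

lemma int2_add {f g : (ℝ × ℝ) × ℝ → ℝ} (hf : Continuous f) (hg : Continuous g) (t : ℝ) :
    ∫ x in (0:ℝ)..(2 * π), ∫ y in (0:ℝ)..(2 * π), (f ((x, y), t) + g ((x, y), t)) =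
    (∫ x in (0:ℝ)..(2 * π), ∫ y in (0:ℝ)..(2 * π), f ((x, y), t)) +
    ∫ x in (0:ℝ)..(2 * π), ∫ y in (0:ℝ)..(2 * π), g ((x, y), t) := by
  have key : ∀ f : (ℝ × ℝ) × ℝ → ℝ, Continuous f →
      (∀ x, IntervalIntegrable (fun y => f ((x, y), t)) MeasureTheory.volume 0 (2 * π)) ∧
      IntervalIntegrable (fun x => ∫ y in (0:ℝ)..(2 * π), f ((x, y), t))
        MeasureTheory.volume 0 (2 * π) := by
    intro f hf
    refine ⟨fun x => (hf.comp (by fun_prop : Continuous fun y : ℝ => ((x, y), t))).intervalIntegrable _ _, ?_⟩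
    apply Continuous.intervalIntegrable
    exact intervalIntegral.continuous_parametric_intervalIntegral_of_continuous' (f := fun x y => f ((x, y), t))
      (hf.comp (by fun_prop : Continuous fun p : ℝ × ℝ => ((p.1, p.2), t))) _ _
  rw [← intervalIntegral.integral_add (key f hf).2 (key g hg).2]
  congr 1
  funext x
  exact intervalIntegral.integral_add ((key f hf).1 x) ((key g hg).1 x)

/-- Two-dimensional energy balance for the chemotaxis system with classical
diffusion: (1/2) d/dt ∫(u² + q₁² + q₂²) dx = −∫ |∇u|² dx. -/
theorem energy_balance_L2_2d
    (u q₁ q₂ : (ℝ × ℝ) × ℝ → ℝ)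
    (hu : ContDiff ℝ (⊤ : ℕ∞) u) (hq₁ : ContDiff ℝ (⊤ : ℕ∞) q₁) (hq₂ : ContDiff ℝ (⊤ : ℕ∞) q₂)
    (hu_per1 : ∀ x y t : ℝ, u ((x + 2 * π, y), t) = u ((x, y), t))
    (hu_per2 : ∀ x y t : ℝ, u ((x, y + 2 * π), t) = u ((x, y), t))
    (hq₁_per1 : ∀ x y t : ℝ, q₁ ((x + 2 * π, y), t) = q₁ ((x, y), t))
    (hq₁_per2 : ∀ x y t : ℝ, q₁ ((x, y + 2 * π), t) = q₁ ((x, y), t))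
    (hq₂_per1 : ∀ x y t : ℝ, q₂ ((x + 2 * π, y), t) = q₂ ((x, y), t))
    (hq₂_per2 : ∀ x y t : ℝ, q₂ ((x, y + 2 * π), t) = q₂ ((x, y), t))
    (heq_u : ∀ p : (ℝ × ℝ) × ℝ,
      pdt u p = lap u p + pd1 (fun r => u r * q₁ r) p + pd2 (fun r => u r * q₂ r) p)
    (heq_q₁ : ∀ p : (ℝ × ℝ) × ℝ, pdt q₁ p = u p * pd1 u p)
    (heq_q₂ : ∀ p : (ℝ × ℝ) × ℝ, pdt q₂ p = u p * pd2 u p) :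
    ∀ t : ℝ,
      HasDerivAt
        (fun s => (1 / 2 : ℝ) *
          ∫ x in (0:ℝ)..(2 * π), ∫ y in (0:ℝ)..(2 * π),
            (u ((x, y), s) ^ 2 + q₁ ((x, y), s) ^ 2 + q₂ ((x, y), s) ^ 2))
        (-∫ x in (0:ℝ)..(2 * π), ∫ y in (0:ℝ)..(2 * π),
            ((pd1 u ((x, y), t)) ^ 2 + (pd2 u ((x, y), t)) ^ 2)) t := by
  intro t
  have hE : ContDiff ℝ (⊤ : ℕ∞) (fun p => u p ^ 2 + q₁ p ^ 2 + q₂ p ^ 2) :=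
    ((hu.pow 2).add (hq₁.pow 2)).add (hq₂.pow 2)
  have hw₁ : ContDiff ℝ (⊤ : ℕ∞) (fun p => u p * q₁ p) := hu.mul hq₁
  have hw₂ : ContDiff ℝ (⊤ : ℕ∞) (fun p => u p * q₂ p) := hu.mul hq₂
  have hg₁ : ContDiff ℝ (⊤ : ℕ∞) (fun p => pd1 u p + u p * q₁ p) := (sm1 hu).add hw₁
  have hg₂ : ContDiff ℝ (⊤ : ℕ∞) (fun p => pd2 u p + u p * q₂ p) := (sm2 hu).add hw₂
  have hA : ContDiff ℝ (⊤ : ℕ∞) (fun p => u p * (pd1 u p + u p * q₁ p)) := hu.mul hg₁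
  have hB : ContDiff ℝ (⊤ : ℕ∞) (fun p => u p * (pd2 u p + u p * q₂ p)) := hu.mul hg₂
  have hD : Continuous (fun p => pd1 u p ^ 2 + pd2 u p ^ 2) :=
    ((sm1 hu).continuous.pow 2).add ((sm2 hu).continuous.pow 2)
  have e1 : ∀ p, pd1 (fun p => pd1 u p + u p * q₁ p) p
      = pd1 (pd1 u) p + pd1 (fun r => u r * q₁ r) p := fun p =>
    ((hd1 (sm1 hu) p.1.1 p.1.2 p.2).add (hd1 hw₁ p.1.1 p.1.2 p.2)).deriv
  have e2 : ∀ p, pd2 (fun p => pd2 u p + u p * q₂ p) p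
      = pd2 (pd2 u) p + pd2 (fun r => u r * q₂ r) p := fun p =>
    ((hd2 (sm2 hu) p.1.1 p.1.2 p.2).add (hd2 hw₂ p.1.1 p.1.2 p.2)).deriv
  have ht : ∀ p, pdt (fun p => u p ^ 2 + q₁ p ^ 2 + q₂ p ^ 2) p
      = 2 * (u p * pdt u p + q₁ p * pdt q₁ p + q₂ p * pdt q₂ p) := by
    intro p
    have := ((((hdt hu p.1.1 p.1.2 p.2).pow 2).add ((hdt hq₁ p.1.1 p.1.2 p.2).pow 2)).add
      ((hdt hq₂ p.1.1 p.1.2 p.2).pow 2)).deriv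
    refine Eq.trans this ?_
    simp
    ring
  have hpt : ∀ p, (1 / 2 : ℝ) * pdt (fun p => u p ^ 2 + q₁ p ^ 2 + q₂ p ^ 2) p
      + (pd1 u p ^ 2 + pd2 u p ^ 2)
      = pd1 (fun p => u p * (pd1 u p + u p * q₁ p)) p
        + pd2 (fun p => u p * (pd2 u p + u p * q₂ p)) p := by
    intro p
    rw [ht, heq_u, heq_q₁, heq_q₂, pd1_mul hu hg₁, pd2_mul hu hg₂, e1, e2, lap]
    ring
  have hI := int2_add (f := fun p => (1 / 2 : ℝ) * pdt (fun p => u p ^ 2 + q₁ p ^ 2 + q₂ p ^ 2) p)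
    (continuous_const.mul (smt hE).continuous) hD t
  simp only [hpt] at hI
  rw [int2_add (sm1 hA).continuous (sm2 hB).continuous t,
    int_pd1 hA (by intro x y t; simp only [hu_per1, hq₁_per1, pd1_per hu_per1])] at hI
  simp only [int_pd2 hB (by intro x y t; simp only [hu_per2, hq₂_per2, pd2_per hu_per2]),
    intervalIntegral.integral_zero, intervalIntegral.integral_const_mul] at hI
  refine ((int_pdt hE t).const_mul (1 / 2 : ℝ)).congr_deriv ?_
  linarith
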